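/- (Equivalence) Let R be a polarized rewrite system such that the relations →₋ and →₊ commute, and let T be the set of formulas containing P ⇒ A for each negative rule P → A of R and A ⇒ P for each positive rule P → A of R. Then for every context Γ and formula A: some proof-term proves Γ ⊢_R A in polarized natural deduction modulo R if and only if A is provable from the hypotheses T ∪ Γ in pure intuitionistic natural deduction (i.e., polarized natural deduction modulo the empty rewrite system). -/

import Mathlib

/-- Propositional formulas: atoms (indexed by naturals), ⊥, ⇒, ∧, ∨. -/
inductive Form : Type where
  | atom : ℕ → Form
  | bot  : Form
  | imp  : Form → Form → Form
  | and  : Form → Form → Form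
  | or   : Form → Form → Form

/-- A polarized rewrite system: a set of negative rules and a set of positive
rules, each rewriting an atomic proposition to an arbitrary formula. -/
structure PRS : Type where
  neg : ℕ → Form → Prop
  pos : ℕ → Form → Prop

mutual
  /-- One step negative rewriting →₋¹. -/
  inductive Neg1 (R : PRS) : Form → Form → Prop where
    | rule {P A} : R.neg P A → Neg1 R (.atom P) A
    | impL {A A' B} : Pos1 R A A' → Neg1 R (.imp A B) (.imp A' B)
    | impR {A B B'} : Neg1 R B B' → Neg1 R (.imp A B) (.imp A B')
    | andL {A A' B} : Neg1 R A A' → Neg1 R (.and A B) (.and A' B)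
    | andR {A B B'} : Neg1 R B B' → Neg1 R (.and A B) (.and A B')
    | orL  {A A' B} : Neg1 R A A' → Neg1 R (.or A B) (.or A' B)
    | orR  {A B B'} : Neg1 R B B' → Neg1 R (.or A B) (.or A B')
  /-- One step positive rewriting →₊¹. -/
  inductive Pos1 (R : PRS) : Form → Form → Prop where
    | rule {P A} : R.pos P A → Pos1 R (.atom P) A
    | impL {A A' B} : Neg1 R A A' → Pos1 R (.imp A B) (.imp A' B)
    | impR {A B B'} : Pos1 R B B' → Pos1 R (.imp A B) (.imp A B')
    | andL {A A' B} : Pos1 R A A' → Pos1 R (.and A B) (.and A' B)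
    | andR {A B B'} : Pos1 R B B' → Pos1 R (.and A B) (.and A B')
    | orL  {A A' B} : Pos1 R A A' → Pos1 R (.or A B) (.or A' B)
    | orR  {A B B'} : Pos1 R B B' → Pos1 R (.or A B) (.or A B')
end

/-- →₋ : reflexive-transitive closure of →₋¹. -/
def NegR (R : PRS) : Form → Form → Prop := Relation.ReflTransGen (Neg1 R)

/-- →₊ : reflexive-transitive closure of →₊¹. -/
def PosR (R : PRS) : Form → Form → Prop := Relation.ReflTransGen (Pos1 R)

/-- The relations →₋ and →₊ commute. -/
def Commutes (R : PRS) : Prop :=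
  ∀ A B C, NegR R B A → PosR R B C → ∃ D, PosR R A D ∧ NegR R C D

/-- Proof-terms (de Bruijn representation of the proof variables). -/
inductive PTerm : Type where
  | var  : ℕ → PTerm
  | lam  : PTerm → PTerm
  | app  : PTerm → PTerm → PTerm
  | pair : PTerm → PTerm → PTerm
  | fst  : PTerm → PTerm
  | snd  : PTerm → PTerm
  | inl  : PTerm → PTerm
  | inr  : PTerm → PTerm
  | case : PTerm → PTerm → PTerm → PTerm
  | exf  : PTerm → PTerm

/-- Shift by one all de Bruijn indices ≥ c. -/
def liftAbove (c : ℕ) : PTerm → PTerm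
  | .var n => if n < c then .var n else .var (n+1)
  | .lam π => .lam (liftAbove (c+1) π)
  | .app a b => .app (liftAbove c a) (liftAbove c b)
  | .pair a b => .pair (liftAbove c a) (liftAbove c b)
  | .fst a => .fst (liftAbove c a)
  | .snd a => .snd (liftAbove c a)
  | .inl a => .inl (liftAbove c a)
  | .inr a => .inr (liftAbove c a)
  | .case a b c' => .case (liftAbove c a) (liftAbove (c+1) b) (liftAbove (c+1) c')
  | .exf a => .exf (liftAbove c a)

/-- Substitution [u/k]π of the term u for the variable k. -/
def subst (k : ℕ) (u : PTerm) : PTerm → PTerm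
  | .var n => if n < k then .var n else if n = k then u else .var (n-1)
  | .lam π => .lam (subst (k+1) (liftAbove 0 u) π)
  | .app a b => .app (subst k u a) (subst k u b)
  | .pair a b => .pair (subst k u a) (subst k u b)
  | .fst a => .fst (subst k u a)
  | .snd a => .snd (subst k u a)
  | .inl a => .inl (subst k u a)
  | .inr a => .inr (subst k u a)
  | .case a b c => .case (subst k u a) (subst (k+1) (liftAbove 0 u) b) (subst (k+1) (liftAbove 0 u) c)
  | .exf a => .exf (subst k u a)

/-- Typing judgement of polarized natural deduction modulo R:
`Typed R Γ π A` means "π is a proof-term of Γ ⊢_R A".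
A context is a finite list of formulas (the declaration of variable n is the
n-th entry of the list). -/
inductive Typed (R : PRS) : List Form → PTerm → Form → Prop where
  | ax {Γ n A B C} : Γ[n]? = some A → NegR R A C → PosR R B C →
      Typed R Γ (.var n) B
  | impI {Γ π A B C} : Typed R (A :: Γ) π B → PosR R C (.imp A B) →
      Typed R Γ (.lam π) C
  | impE {Γ π₁ π₂ A B C} : Typed R Γ π₁ C → NegR R C (.imp A B) →
      Typed R Γ π₂ A → Typed R Γ (.app π₁ π₂) B
  | andI {Γ π₁ π₂ A B C} : Typed R Γ π₁ A → Typed R Γ π₂ B →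
      PosR R C (.and A B) → Typed R Γ (.pair π₁ π₂) C
  | andE₁ {Γ π A B C} : Typed R Γ π C → NegR R C (.and A B) →
      Typed R Γ (.fst π) A
  | andE₂ {Γ π A B C} : Typed R Γ π C → NegR R C (.and A B) →
      Typed R Γ (.snd π) B
  | orI₁ {Γ π A B C} : Typed R Γ π A → PosR R C (.or A B) →
      Typed R Γ (.inl π) C
  | orI₂ {Γ π A B C} : Typed R Γ π B → PosR R C (.or A B) →
      Typed R Γ (.inr π) C
  | orE {Γ π₁ π₂ π₃ A B C D} : Typed R Γ π₁ D → NegR R D (.or A B) →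
      Typed R (A :: Γ) π₂ C → Typed R (B :: Γ) π₃ C →
      Typed R Γ (.case π₁ π₂ π₃) C
  | botE {Γ π A B} : Typed R Γ π B → NegR R B .bot →
      Typed R Γ (.exf π) A

/-- One step proof reduction ▷¹ (contextual closure of the cut elimination rules). -/
inductive Red1 : PTerm → PTerm → Prop where
  | beta {π₁ π₂} : Red1 (.app (.lam π₁) π₂) (subst 0 π₂ π₁)
  | fstPair {π₁ π₂} : Red1 (.fst (.pair π₁ π₂)) π₁
  | sndPair {π₁ π₂} : Red1 (.snd (.pair π₁ π₂)) π₂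
  | caseInl {π₁ π₂ π₃} : Red1 (.case (.inl π₁) π₂ π₃) (subst 0 π₁ π₂)
  | caseInr {π₁ π₂ π₃} : Red1 (.case (.inr π₁) π₂ π₃) (subst 0 π₁ π₃)
  | lam {π π'} : Red1 π π' → Red1 (.lam π) (.lam π')
  | appL {π π' ρ} : Red1 π π' → Red1 (.app π ρ) (.app π' ρ)
  | appR {π ρ ρ'} : Red1 ρ ρ' → Red1 (.app π ρ) (.app π ρ')
  | pairL {π π' ρ} : Red1 π π' → Red1 (.pair π ρ) (.pair π' ρ)
  | pairR {π ρ ρ'} : Red1 ρ ρ' → Red1 (.pair π ρ) (.pair π ρ')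
  | fst {π π'} : Red1 π π' → Red1 (.fst π) (.fst π')
  | snd {π π'} : Red1 π π' → Red1 (.snd π) (.snd π')
  | inl {π π'} : Red1 π π' → Red1 (.inl π) (.inl π')
  | inr {π π'} : Red1 π π' → Red1 (.inr π) (.inr π')
  | case₁ {π π' ρ τ} : Red1 π π' → Red1 (.case π ρ τ) (.case π' ρ τ)
  | case₂ {π ρ ρ' τ} : Red1 ρ ρ' → Red1 (.case π ρ τ) (.case π ρ' τ)
  | case₃ {π ρ τ τ'} : Red1 τ τ' → Red1 (.case π ρ τ) (.case π ρ τ')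
  | exf {π π'} : Red1 π π' → Red1 (.exf π) (.exf π')

/-- ▷ : reflexive-transitive closure of ▷¹. -/
def Red : PTerm → PTerm → Prop := Relation.ReflTransGen Red1

/-- A proof-term is strongly normalizable if every ▷¹-reduction sequence from
it is finite, i.e. it is accessible for the inverse of ▷¹. -/
def SN (π : PTerm) : Prop := Acc (fun x y => Red1 y x) π

/-- Neutral proof-terms: variables and eliminations, not introductions. -/
def Neutral : PTerm → Prop
  | .var _ => True
  | .app _ _ => True
  | .fst _ => True
  | .snd _ => True
  | .case _ _ _ => True
  | .exf _ => True
  | _ => False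

/-- Reducibility candidates. -/
structure IsCandidate (S : Set PTerm) : Prop where
  sn : ∀ π ∈ S, SN π
  closed : ∀ π ∈ S, ∀ π', Red π π' → π' ∈ S
  neutral : ∀ π, Neutral π → (∀ π', Red1 π π' → π' ∈ S) → π ∈ S

/-- A pre-model is an assignment of a reducibility candidate to each atom. -/
def IsPreModel (M : ℕ → Set PTerm) : Prop := ∀ P, IsCandidate (M P)

/-- The interpretation |A| of a formula in a pre-model. -/
def interp (M : ℕ → Set PTerm) : Form → Set PTerm
  | .atom P => M P
  | .bot => {π | SN π}
  | .imp A B => {π | SN π ∧ ∀ π₁, Red π (.lam π₁) →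
      ∀ π' ∈ interp M A, subst 0 π' π₁ ∈ interp M B}
  | .and A B => {π | SN π ∧ ∀ π₁ π₂, Red π (.pair π₁ π₂) →
      π₁ ∈ interp M A ∧ π₂ ∈ interp M B}
  | .or A B => {π | SN π ∧ (∀ π₁, Red π (.inl π₁) → π₁ ∈ interp M A) ∧
      (∀ π₂, Red π (.inr π₂) → π₂ ∈ interp M B)}

/-- A pre-model of a polarized rewrite system R. -/
def IsPreModelOf (R : PRS) (M : ℕ → Set PTerm) : Prop :=
  IsPreModel M ∧
  (∀ P A, R.neg P A → interp M (.atom P) ⊆ interp M A) ∧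
  (∀ P A, R.pos P A → interp M A ⊆ interp M (.atom P))

/-- The empty polarized rewrite system; polarized natural deduction modulo it is
pure intuitionistic natural deduction. -/
def emptyPRS : PRS := ⟨fun _ _ => False, fun _ _ => False⟩

/-- The set of axioms associated with a polarized rewrite system R: P ⇒ A for
each negative rule P → A and A ⇒ P for each positive rule P → A. -/
def axiomsOf (R : PRS) : Set Form :=
  {F | ∃ P A, R.neg P A ∧ F = .imp (.atom P) A} ∪
  {F | ∃ P A, R.pos P A ∧ F = .imp A (.atom P)}

/-- A is provable from the (possibly infinite) set of hypotheses S in pure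
intuitionistic natural deduction. -/
def ProvFrom (S : Set Form) (A : Form) : Prop :=
  ∃ Δ : List Form, (∀ B ∈ Δ, B ∈ S) ∧ ∃ π, Typed emptyPRS Δ π A

/-- Weakening and exchange, on the level of provability. -/
theorem Typed.weaken {R : PRS} {Δ : List Form} {π : PTerm} {A : Form} (h : Typed R Δ π A) :
    ∀ {Δ' : List Form}, Δ ⊆ Δ' → ∃ π', Typed R Δ' π' A := by
  induction h with
  | ax h hn hp =>
    intro Δ' hs
    obtain ⟨m, hm⟩ := List.mem_iff_getElem?.1 (hs (List.mem_of_getElem? h))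
    exact ⟨_, .ax hm hn hp⟩
  | impI _ hp ih =>
    intro Δ' hs
    obtain ⟨_, h⟩ := ih (List.cons_subset_cons _ hs)
    exact ⟨_, .impI h hp⟩
  | impE _ hn _ ih₁ ih₂ =>
    intro Δ' hs
    obtain ⟨_, h₁⟩ := ih₁ hs
    obtain ⟨_, h₂⟩ := ih₂ hs
    exact ⟨_, .impE h₁ hn h₂⟩
  | andI _ _ hp ih₁ ih₂ =>
    intro Δ' hs
    obtain ⟨_, h₁⟩ := ih₁ hs
    obtain ⟨_, h₂⟩ := ih₂ hs
    exact ⟨_, .andI h₁ h₂ hp⟩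
  | andE₁ _ hn ih =>
    intro Δ' hs
    obtain ⟨_, h⟩ := ih hs
    exact ⟨_, .andE₁ h hn⟩
  | andE₂ _ hn ih =>
    intro Δ' hs
    obtain ⟨_, h⟩ := ih hs
    exact ⟨_, .andE₂ h hn⟩
  | orI₁ _ hp ih =>
    intro Δ' hs
    obtain ⟨_, h⟩ := ih hs
    exact ⟨_, .orI₁ h hp⟩
  | orI₂ _ hp ih =>
    intro Δ' hs
    obtain ⟨_, h⟩ := ih hs
    exact ⟨_, .orI₂ h hp⟩
  | orE _ hn _ _ ih₁ ih₂ ih₃ =>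
    intro Δ' hs
    obtain ⟨_, h₁⟩ := ih₁ hs
    obtain ⟨_, h₂⟩ := ih₂ (List.cons_subset_cons _ hs)
    obtain ⟨_, h₃⟩ := ih₃ (List.cons_subset_cons _ hs)
    exact ⟨_, .orE h₁ hn h₂ h₃⟩
  | botE _ hn ih =>
    intro Δ' hs
    obtain ⟨_, h⟩ := ih hs
    exact ⟨_, .botE h hn⟩

namespace ProvFrom

variable {S S' : Set Form} {A B C : Form}

theorem mono (h : ProvFrom S A) (hs : S ⊆ S') : ProvFrom S' A := by
  obtain ⟨Δ, hΔ, hπ⟩ := h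
  exact ⟨Δ, fun B hB => hs (hΔ B hB), hπ⟩

theorem hyp (h : A ∈ S) : ProvFrom S A :=
  ⟨[A], by simpa using h, .var 0, .ax (A := A) (C := A) rfl .refl .refl⟩

/-- The hypotheses used by a proof from `insert A S` can be split into `A` and a finite
part of `S`. -/
theorem exists_cons (h : ProvFrom (insert A S) B) :
    ∃ Δ : List Form, (∀ C ∈ Δ, C ∈ S) ∧ ∃ π, Typed emptyPRS (A :: Δ) π B := by
  classical
  obtain ⟨Δ, hΔ, π, hπ⟩ := h
  refine ⟨Δ.filter (· ≠ A), fun C hC => ?_, hπ.weaken fun C hC => ?_⟩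
  · obtain ⟨hC, hne⟩ := List.mem_filter.1 hC
    exact (hΔ C hC).resolve_left (by simpa using hne)
  · by_cases hCA : C = A <;> simp [hCA, hC]

theorem impI (h : ProvFrom (insert A S) B) : ProvFrom S (.imp A B) := by
  obtain ⟨Δ, hΔ, _, hπ⟩ := h.exists_cons
  exact ⟨Δ, hΔ, _, .impI hπ .refl⟩

theorem impE (h₁ : ProvFrom S (.imp A B)) (h₂ : ProvFrom S A) : ProvFrom S B := by
  obtain ⟨Δ₁, hΔ₁, _, hπ₁⟩ := h₁
  obtain ⟨Δ₂, hΔ₂, _, hπ₂⟩ := h₂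
  obtain ⟨_, h₁⟩ := hπ₁.weaken (List.subset_append_left Δ₁ Δ₂)
  obtain ⟨_, h₂⟩ := hπ₂.weaken (List.subset_append_right Δ₁ Δ₂)
  exact ⟨Δ₁ ++ Δ₂, fun C hC => (List.mem_append.1 hC).elim (hΔ₁ C) (hΔ₂ C), _,
    .impE h₁ .refl h₂⟩

theorem andI (h₁ : ProvFrom S A) (h₂ : ProvFrom S B) : ProvFrom S (.and A B) := by
  obtain ⟨Δ₁, hΔ₁, _, hπ₁⟩ := h₁
  obtain ⟨Δ₂, hΔ₂, _, hπ₂⟩ := h₂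
  obtain ⟨_, h₁⟩ := hπ₁.weaken (List.subset_append_left Δ₁ Δ₂)
  obtain ⟨_, h₂⟩ := hπ₂.weaken (List.subset_append_right Δ₁ Δ₂)
  exact ⟨Δ₁ ++ Δ₂, fun C hC => (List.mem_append.1 hC).elim (hΔ₁ C) (hΔ₂ C), _,
    .andI h₁ h₂ .refl⟩

theorem andE₁ (h : ProvFrom S (.and A B)) : ProvFrom S A := by
  obtain ⟨Δ, hΔ, _, hπ⟩ := h
  exact ⟨Δ, hΔ, _, .andE₁ hπ .refl⟩

theorem andE₂ (h : ProvFrom S (.and A B)) : ProvFrom S B := by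
  obtain ⟨Δ, hΔ, _, hπ⟩ := h
  exact ⟨Δ, hΔ, _, .andE₂ hπ .refl⟩

theorem orI₁ (h : ProvFrom S A) : ProvFrom S (.or A B) := by
  obtain ⟨Δ, hΔ, _, hπ⟩ := h
  exact ⟨Δ, hΔ, _, .orI₁ hπ .refl⟩

theorem orI₂ (h : ProvFrom S B) : ProvFrom S (.or A B) := by
  obtain ⟨Δ, hΔ, _, hπ⟩ := h
  exact ⟨Δ, hΔ, _, .orI₂ hπ .refl⟩

theorem botE (h : ProvFrom S .bot) : ProvFrom S A := by
  obtain ⟨Δ, hΔ, _, hπ⟩ := h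
  exact ⟨Δ, hΔ, _, .botE hπ .refl⟩

theorem orE (h : ProvFrom S (.or A B)) (hA : ProvFrom (insert A S) C)
    (hB : ProvFrom (insert B S) C) : ProvFrom S C := by
  have key : ProvFrom ∅ (.imp (.or A B) (.imp (.imp A C) (.imp (.imp B C) C))) := by
    refine ⟨[], by simp, .lam (.lam (.lam (.case (.var 2)
      (.app (.var 2) (.var 0)) (.app (.var 1) (.var 0))))), ?_⟩
    refine .impI (.impI (.impI (.orE (A := A) (B := B) (.ax rfl .refl .refl) .refl ?_ ?_)
      .refl) .refl) .refl
    · exact .impE (A := A) (.ax rfl .refl .refl) .refl (.ax rfl .refl .refl)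
    · exact .impE (A := B) (.ax rfl .refl .refl) .refl (.ax rfl .refl .refl)
  exact (((key.mono (Set.empty_subset S)).impE h).impE hA.impI).impE hB.impI

end ProvFrom

mutual

/-- In the presence of the axioms of `R`, a negative step preserves provability. -/
theorem Neg1.provFrom {R : PRS} {A A' : Form} (h : Neg1 R A A') {S : Set Form}
    (hS : axiomsOf R ⊆ S) (hA : ProvFrom S A) : ProvFrom S A' :=
  have ext (B : Form) : axiomsOf R ⊆ insert B S := hS.trans (Set.subset_insert B S)
  have lift {B C : Form} (h : ProvFrom S B) : ProvFrom (insert C S) B :=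
    h.mono (Set.subset_insert C S)
  have top {B : Form} : ProvFrom (insert B S) B := .hyp (Set.mem_insert B S)
  match h with
  | .rule r => .impE (.hyp (hS (.inl ⟨_, _, r, rfl⟩))) hA
  | .impL h => .impI ((lift hA).impE (h.provFrom (ext _) top))
  | .impR h => .impI (h.provFrom (ext _) ((lift hA).impE top))
  | .andL h => .andI (h.provFrom hS hA.andE₁) hA.andE₂
  | .andR h => .andI hA.andE₁ (h.provFrom hS hA.andE₂)
  | .orL h => hA.orE (.orI₁ (h.provFrom (ext _) top)) top.orI₂
  | .orR h => hA.orE top.orI₁ (.orI₂ (h.provFrom (ext _) top))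

/-- In the presence of the axioms of `R`, a positive step reflects provability. -/
theorem Pos1.provFrom {R : PRS} {A A' : Form} (h : Pos1 R A A') {S : Set Form}
    (hS : axiomsOf R ⊆ S) (hA : ProvFrom S A') : ProvFrom S A :=
  have ext (B : Form) : axiomsOf R ⊆ insert B S := hS.trans (Set.subset_insert B S)
  have lift {B C : Form} (h : ProvFrom S B) : ProvFrom (insert C S) B :=
    h.mono (Set.subset_insert C S)
  have top {B : Form} : ProvFrom (insert B S) B := .hyp (Set.mem_insert B S)
  match h with
  | .rule r => .impE (.hyp (hS (.inr ⟨_, _, r, rfl⟩))) hA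
  | .impL h => .impI ((lift hA).impE (h.provFrom (ext _) top))
  | .impR h => .impI (h.provFrom (ext _) ((lift hA).impE top))
  | .andL h => .andI (h.provFrom hS hA.andE₁) hA.andE₂
  | .andR h => .andI hA.andE₁ (h.provFrom hS hA.andE₂)
  | .orL h => hA.orE (.orI₁ (h.provFrom (ext _) top)) top.orI₂
  | .orR h => hA.orE top.orI₁ (.orI₂ (h.provFrom (ext _) top))

end

theorem NegR.provFrom {R : PRS} {A A' : Form} (h : NegR R A A') {S : Set Form}
    (hS : axiomsOf R ⊆ S) (hA : ProvFrom S A) : ProvFrom S A' := by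
  induction h with
  | refl => exact hA
  | tail _ h ih => exact h.provFrom hS ih

theorem PosR.provFrom {R : PRS} {A A' : Form} (h : PosR R A A') {S : Set Form}
    (hS : axiomsOf R ⊆ S) (hA : ProvFrom S A') : ProvFrom S A := by
  induction h with
  | refl => exact hA
  | tail _ h ih => exact ih (h.provFrom hS hA)

/-- Every proof modulo `R` translates to a pure proof from the axioms of `R`. -/
theorem Typed.provFrom {R : PRS} {Γ : List Form} {π : PTerm} {A : Form}
    (h : Typed R Γ π A) : ProvFrom (axiomsOf R ∪ {B | B ∈ Γ}) A := by
  have hT (Γ : List Form) : axiomsOf R ⊆ axiomsOf R ∪ {B | B ∈ Γ} := Set.subset_union_left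
  have cons {Γ : List Form} {A B : Form}
      (h : ProvFrom (axiomsOf R ∪ {C | C ∈ A :: Γ}) B) :
      ProvFrom (insert A (axiomsOf R ∪ {C | C ∈ Γ})) B := by
    refine h.mono fun C hC => ?_
    simp only [Set.mem_union, Set.mem_ofPred_eq, List.mem_cons, Set.mem_insert_iff] at hC ⊢
    tauto
  induction h with
  | ax h hn hp =>
    exact hp.provFrom (hT _)
      (hn.provFrom (hT _) (.hyp (Set.mem_union_right _ (List.mem_of_getElem? h))))
  | impI _ hp ih => exact hp.provFrom (hT _) (cons ih).impI
  | impE _ hn _ ih₁ ih₂ => exact (hn.provFrom (hT _) ih₁).impE ih₂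
  | andI _ _ hp ih₁ ih₂ => exact hp.provFrom (hT _) (ih₁.andI ih₂)
  | andE₁ _ hn ih => exact (hn.provFrom (hT _) ih).andE₁
  | andE₂ _ hn ih => exact (hn.provFrom (hT _) ih).andE₂
  | orI₁ _ hp ih => exact hp.provFrom (hT _) ih.orI₁
  | orI₂ _ hp ih => exact hp.provFrom (hT _) ih.orI₂
  | orE _ hn _ _ ih₁ ih₂ ih₃ => exact (hn.provFrom (hT _) ih₁).orE (cons ih₂) (cons ih₃)
  | botE _ hn ih => exact (hn.provFrom (hT _) ih).botE

theorem not_neg1_emptyPRS_and_not_pos1_emptyPRS (A : Form) :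
    (∀ B, ¬ Neg1 emptyPRS A B) ∧ ∀ B, ¬ Pos1 emptyPRS A B := by
  induction A with
  | atom P => exact ⟨fun B h => by cases h; assumption, fun B h => by cases h; assumption⟩
  | bot => exact ⟨nofun, nofun⟩
  | imp A B ihA ihB =>
    exact ⟨fun _ h => by cases h with
        | impL h => exact ihA.2 _ h
        | impR h => exact ihB.1 _ h,
      fun _ h => by cases h with
        | impL h => exact ihA.1 _ h
        | impR h => exact ihB.2 _ h⟩
  | and A B ihA ihB =>
    exact ⟨fun _ h => by cases h with
        | andL h => exact ihA.1 _ h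
        | andR h => exact ihB.1 _ h,
      fun _ h => by cases h with
        | andL h => exact ihA.2 _ h
        | andR h => exact ihB.2 _ h⟩
  | or A B ihA ihB =>
    exact ⟨fun _ h => by cases h with
        | orL h => exact ihA.1 _ h
        | orR h => exact ihB.1 _ h,
      fun _ h => by cases h with
        | orL h => exact ihA.2 _ h
        | orR h => exact ihB.2 _ h⟩

theorem NegR.eq_of_emptyPRS {A B : Form} (h : NegR emptyPRS A B) : A = B := by
  induction h with
  | refl => rfl
  | tail _ h _ => exact ((not_neg1_emptyPRS_and_not_pos1_emptyPRS _).1 _ h).elim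

theorem PosR.eq_of_emptyPRS {A B : Form} (h : PosR emptyPRS A B) : A = B := by
  induction h with
  | refl => rfl
  | tail _ h _ => exact ((not_neg1_emptyPRS_and_not_pos1_emptyPRS _).2 _ h).elim

/-- The axioms of `R` are provable modulo `R`, in any context. -/
theorem exists_typed_of_mem_axiomsOf {R : PRS} {A : Form} (h : A ∈ axiomsOf R)
    (Γ : List Form) : ∃ π, Typed R Γ π A := by
  rcases h with ⟨P, A, r, rfl⟩ | ⟨P, A, r, rfl⟩
  · exact ⟨.lam (.var 0), .impI (.ax rfl (.single (.rule r)) .refl) .refl⟩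
  · exact ⟨.lam (.var 0), .impI (.ax rfl .refl (.single (.rule r))) .refl⟩

/-- Rewriting by the empty system is trivial, so it embeds in rewriting by any `R`. -/
theorem NegR.of_emptyPRS {R : PRS} {A B : Form} (h : NegR emptyPRS A B) : NegR R A B :=
  h.eq_of_emptyPRS ▸ .refl

theorem PosR.of_emptyPRS {R : PRS} {A B : Form} (h : PosR emptyPRS A B) : PosR R A B :=
  h.eq_of_emptyPRS ▸ .refl

/-- A pure proof whose hypotheses lie in `Γ` or among the axioms of `R` yields a proof
modulo `R` in the context `Γ`. -/
theorem Typed.exists_typed_of_emptyPRS {R : PRS} {Δ : List Form} {π : PTerm} {A : Form}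
    (h : Typed emptyPRS Δ π A) :
    ∀ {Γ : List Form}, (∀ B ∈ Δ, B ∈ axiomsOf R ∪ {B | B ∈ Γ}) → ∃ π', Typed R Γ π' A := by
  have cons {Δ Γ : List Form} (A : Form) (hs : ∀ B ∈ Δ, B ∈ axiomsOf R ∪ {B | B ∈ Γ}) :
      ∀ B ∈ A :: Δ, B ∈ axiomsOf R ∪ {B | B ∈ A :: Γ} := by
    intro B hB
    rcases List.mem_cons.1 hB with rfl | hB
    · exact .inr List.mem_cons_self
    · exact (hs B hB).imp_right (List.mem_cons_of_mem A)
  induction h with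
  | ax h hn hp =>
    intro Γ hs
    obtain rfl := hn.eq_of_emptyPRS
    obtain rfl := hp.eq_of_emptyPRS
    rcases hs _ (List.mem_of_getElem? h) with hT | hΓ
    · exact exists_typed_of_mem_axiomsOf hT Γ
    · obtain ⟨m, hm⟩ := List.mem_iff_getElem?.1 hΓ
      exact ⟨_, .ax hm .refl .refl⟩
  | impI _ hp ih =>
    intro Γ hs
    obtain ⟨_, h⟩ := ih (cons _ hs)
    exact ⟨_, .impI h hp.of_emptyPRS⟩
  | impE _ hn _ ih₁ ih₂ =>
    intro Γ hs
    obtain ⟨_, h₁⟩ := ih₁ hs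
    obtain ⟨_, h₂⟩ := ih₂ hs
    exact ⟨_, .impE h₁ hn.of_emptyPRS h₂⟩
  | andI _ _ hp ih₁ ih₂ =>
    intro Γ hs
    obtain ⟨_, h₁⟩ := ih₁ hs
    obtain ⟨_, h₂⟩ := ih₂ hs
    exact ⟨_, .andI h₁ h₂ hp.of_emptyPRS⟩
  | andE₁ _ hn ih =>
    intro Γ hs
    obtain ⟨_, h⟩ := ih hs
    exact ⟨_, .andE₁ h hn.of_emptyPRS⟩
  | andE₂ _ hn ih =>
    intro Γ hs
    obtain ⟨_, h⟩ := ih hs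
    exact ⟨_, .andE₂ h hn.of_emptyPRS⟩
  | orI₁ _ hp ih =>
    intro Γ hs
    obtain ⟨_, h⟩ := ih hs
    exact ⟨_, .orI₁ h hp.of_emptyPRS⟩
  | orI₂ _ hp ih =>
    intro Γ hs
    obtain ⟨_, h⟩ := ih hs
    exact ⟨_, .orI₂ h hp.of_emptyPRS⟩
  | orE _ hn _ _ ih₁ ih₂ ih₃ =>
    intro Γ hs
    obtain ⟨_, h₁⟩ := ih₁ hs
    obtain ⟨_, h₂⟩ := ih₂ (cons _ hs)
    obtain ⟨_, h₃⟩ := ih₃ (cons _ hs)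
    exact ⟨_, .orE h₁ hn.of_emptyPRS h₂ h₃⟩
  | botE _ hn ih =>
    intro Γ hs
    obtain ⟨_, h⟩ := ih hs
    exact ⟨_, .botE h hn.of_emptyPRS⟩

/-- Equivalence: if →₋ and →₊ commute then Γ ⊢_R A is provable in polarized
natural deduction modulo R iff A is provable from T ∪ Γ in pure intuitionistic
natural deduction, where T is the set of axioms associated with R. -/
theorem equivalence (R : PRS) (hcomm : Commutes R)
    (Γ : List Form) (A : Form) :
    (∃ π, Typed R Γ π A) ↔ ProvFrom (axiomsOf R ∪ {B | B ∈ Γ}) A := by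
  exact ⟨fun ⟨_, h⟩ => h.provFrom, fun ⟨_, hΔ, _, h⟩ => h.exists_typed_of_emptyPRS hΔ⟩
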